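/- Let λ, μ ∈ X⁺ be dominant weights, γ ∈ R⁺, w ∈ W, and n ∈ ℤ with w·μ = λ − nγ and (n < 0 or n > ⟨λ+ρ,γ∨⟩). (a) If w⁻¹γ ∈ R⁺, then n < 0 and, setting β = w⁻¹γ and m = −n, one has 0 < m < (1/2)⟨μ+ρ,β∨⟩ (in particular (w⁻¹, m) ∈ V_β(λ,μ)). (b) If −w⁻¹γ ∈ R⁺, then n > ⟨λ+ρ,γ∨⟩ and, setting β = −w⁻¹γ and m = n, one has (1/2)⟨μ+ρ,β∨⟩ < m < ⟨μ+ρ,β∨⟩ (in particular (w⁻¹, m) ∈ V_β(λ,μ)). -/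

import Mathlib

open scoped InnerProductSpace Classical

noncomputable section

variable {E : Type*} [NormedAddCommGroup E] [InnerProductSpace ℝ E]

/-- `⟨x, α∨⟩ = 2⟪x,α⟫/⟪α,α⟫`. -/
def coPair (x α : E) : ℝ := 2 * ⟪x, α⟫_ℝ / ⟪α, α⟫_ℝ

/-- The orthogonal reflection `s_α(x) = x − ⟨x,α∨⟩α`, as a plain function. -/
def sRefl (α x : E) : E := x - coPair x α • α

/-- `R` is a finite crystallographic root system in `E`. -/
structure IsRootSystem (R : Finset E) : Prop where
  span_eq_top : Submodule.span ℝ (R : Set E) = ⊤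
  zero_not_mem : (0 : E) ∉ R
  refl_stable : ∀ α ∈ R, ∀ β ∈ R, sRefl α β ∈ R
  crystallographic : ∀ α ∈ R, ∀ β ∈ R, ∃ n : ℤ, coPair β α = (n : ℝ)

/-- The positive roots with respect to a regular vector `v`. -/
def posR (R : Finset E) (v : E) : Finset E := R.filter fun α => 0 < ⟪v, α⟫_ℝ

/-- `ρ`, the half sum of the positive roots. -/
def rhoR (R : Finset E) (v : E) : E := (2 : ℝ)⁻¹ • ∑ α ∈ posR R v, α

/-- The Weyl group: the group of linear isometries of `E` generated by the
reflections `s_α`, `α ∈ R`. -/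
def Weyl (R : Finset E) : Subgroup (E ≃ₗᵢ[ℝ] E) :=
  Subgroup.closure {g | ∃ α ∈ R, ∀ x, g x = sRefl α x}

/-- The dot action `w·λ = w(λ+ρ) − ρ`. -/
def dotAct (R : Finset E) (v : E) (w : E ≃ₗᵢ[ℝ] E) (lam : E) : E :=
  w (lam + rhoR R v) - rhoR R v

/-- membership in the weight lattice `X`. -/
def IsWeight (R : Finset E) (lam : E) : Prop := ∀ α ∈ R, ∃ n : ℤ, coPair lam α = (n : ℝ)

/-- membership in `X⁺`, the set of dominant weights. -/
def IsDominant (R : Finset E) (v : E) (lam : E) : Prop :=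
  IsWeight R lam ∧ ∀ α ∈ posR R v, 0 ≤ coPair lam α

/-- the strict dominance order `λ < μ`:  `μ − λ` is a nonzero `ℕ`-linear
combination of positive roots. -/
def domLt (R : Finset E) (v : E) (lam mu : E) : Prop :=
  lam ≠ mu ∧ ∃ c : E → ℕ, mu - lam = ∑ α ∈ posR R v, (c α : ℝ) • α

/-- `V_β(λ,μ)`. -/
def VsetB (R : Finset E) (v lam mu β : E) : Set ((E ≃ₗᵢ[ℝ] E) × ℤ) :=
  {p | p.1 ∈ Weyl R ∧ 0 < p.2 ∧ (p.2 : ℝ) < coPair (mu + rhoR R v) β ∧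
    dotAct R v p.1 lam = mu - (p.2 : ℝ) • β}

/-- `U_γ(λ,μ)`. -/
def UsetG (R : Finset E) (v lam mu γ : E) : Set ((E ≃ₗᵢ[ℝ] E) × ℤ) :=
  {p | p.1 ∈ Weyl R ∧ (p.2 < 0 ∨ coPair (lam + rhoR R v) γ < (p.2 : ℝ)) ∧
    dotAct R v p.1 mu = lam - (p.2 : ℝ) • γ}

/-- `V(λ,μ)`. -/
def Vset (R : Finset E) (v lam mu : E) : Set (E × (E ≃ₗᵢ[ℝ] E) × ℤ) :=
  {t | t.1 ∈ posR R v ∧ (t.2.1, t.2.2) ∈ VsetB R v lam mu t.1}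

/-- `U(λ,μ)`. -/
def Uset (R : Finset E) (v lam mu : E) : Set (E × (E ≃ₗᵢ[ℝ] E) × ℤ) :=
  {t | t.1 ∈ posR R v ∧ (t.2.1, t.2.2) ∈ UsetG R v lam mu t.1}

lemma sRefl_sRefl {α : E} (hα : α ≠ 0) (x : E) : sRefl α (sRefl α x) = x := by
  have h : ⟪α, α⟫_ℝ ≠ 0 := inner_self_ne_zero.mpr hα
  have hc : coPair (sRefl α x) α = -coPair x α := by
    simp only [sRefl, coPair, inner_sub_left, real_inner_smul_left]
    field_simp
    ring
  rw [sRefl, hc, sRefl]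
  module

lemma inner_sRefl_self {α : E} (hα : α ≠ 0) (x : E) : ⟪sRefl α x, α⟫_ℝ = -⟪x, α⟫_ℝ := by
  have h : ⟪α, α⟫_ℝ ≠ 0 := inner_self_ne_zero.mpr hα
  simp only [sRefl, coPair, inner_sub_left, real_inner_smul_left]
  field_simp
  ring

lemma coPair_pos_iff {α : E} (hα : α ≠ 0) (x : E) : 0 < coPair x α ↔ 0 < ⟪x, α⟫_ℝ := by
  have h : 0 < ⟪α, α⟫_ℝ := real_inner_self_pos.mpr hα
  rw [coPair, div_pos_iff_of_pos_right h]
  constructor <;> intro <;> linarith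

lemma coPair_neg_right (x α : E) : coPair x (-α) = -coPair x α := by
  simp only [coPair, inner_neg_right, inner_neg_left]
  ring

/-- A linear isometry moves across the pairing. -/
lemma coPair_inv_apply (w : E ≃ₗᵢ[ℝ] E) (x α : E) : coPair x (w⁻¹ α) = coPair (w x) α := by
  have h : w (w⁻¹ α) = α := w.apply_symm_apply α
  rw [coPair, coPair, ← w.inner_map_map x, ← w.inner_map_map (w⁻¹ α), h]

lemma ne_zero_of_mem_posR {R : Finset E} {v α : E} (hα : α ∈ posR R v) : α ≠ 0 := by
  rintro rfl
  simp [posR] at hα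

/-- A positive root sent to a non-positive root by `s_α`, with `α` positive, makes an acute
angle with `α`. -/
lemma inner_pos_of_sRefl_notMem {R : Finset E} (hR : IsRootSystem R) {v α β : E}
    (hα : α ∈ posR R v) (hβ : β ∈ posR R v) (h : sRefl α β ∉ posR R v) : 0 < ⟪β, α⟫_ℝ := by
  have hα0 := ne_zero_of_mem_posR hα
  simp only [posR, Finset.mem_filter] at hα hβ h
  have hs : ⟪v, sRefl α β⟫_ℝ ≤ 0 := not_lt.mp fun hlt => h ⟨hR.refl_stable α hα.1 β hβ.1, hlt⟩
  rw [sRefl, inner_sub_right, real_inner_smul_right] at hs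
  rw [← coPair_pos_iff hα0]
  exact pos_of_mul_pos_left (by linarith [hβ.2]) hα.2.le

/-- `ρ` is strictly dominant. -/
lemma coPair_rhoR_pos {R : Finset E} (hR : IsRootSystem R) {v α : E} (hα : α ∈ posR R v) :
    0 < coPair (rhoR R v) α := by
  have hα0 := ne_zero_of_mem_posR hα
  have hstable : (∑ β ∈ posR R v with sRefl α β ∈ posR R v, ⟪β, α⟫_ℝ) = 0 := by
    refine Finset.sum_involution (fun β _ => sRefl α β) ?_ ?_ ?_ ?_
    · intro β _
      rw [inner_sRefl_self hα0, add_neg_cancel]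
    · intro β _ hne heq
      have := inner_sRefl_self hα0 β
      rw [heq] at this
      exact hne (by linarith)
    · intro β hβ
      rw [Finset.mem_filter] at hβ ⊢
      exact ⟨hβ.2, by rw [sRefl_sRefl hα0]; exact hβ.1⟩
    · intro β _
      exact sRefl_sRefl hα0 β
  have hneg : sRefl α α ∉ posR R v := by
    have hinner : ⟪α, α⟫_ℝ ≠ 0 := inner_self_ne_zero.mpr hα0
    have h : sRefl α α = -α := by
      rw [sRefl, coPair, mul_div_assoc, div_self hinner]
      module
    simp only [posR, Finset.mem_filter] at hα ⊢
    rw [h, inner_neg_right]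
    intro h'
    linarith [hα.2, h'.2]
  have hunstable : 0 < ∑ β ∈ posR R v with sRefl α β ∉ posR R v, ⟪β, α⟫_ℝ := by
    refine Finset.sum_pos (fun β hβ => ?_) ⟨α, Finset.mem_filter.mpr ⟨hα, hneg⟩⟩
    rw [Finset.mem_filter] at hβ
    exact inner_pos_of_sRefl_notMem hR hα hβ.1 hβ.2
  rw [coPair_pos_iff hα0, rhoR, real_inner_smul_left, sum_inner,
    ← Finset.sum_filter_add_sum_filter_not (posR R v) (fun β => sRefl α β ∈ posR R v), hstable]
  linarith

lemma IsDominant.coPair_add_rhoR_pos {R : Finset E} (hR : IsRootSystem R) {v lam α : E}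
    (hlam : IsDominant R v lam) (hα : α ∈ posR R v) : 0 < coPair (lam + rhoR R v) α := by
  have hadd : coPair (lam + rhoR R v) α = coPair lam α + coPair (rhoR R v) α := by
    simp only [coPair, inner_add_left]
    ring
  linarith [hlam.2 α hα, coPair_rhoR_pos hR hα]

/-- Inverting the relation `w·μ = λ − nγ`. -/
lemma dotAct_inv_of_dotAct_eq {R : Finset E} {v lam mu γ : E} {w : E ≃ₗᵢ[ℝ] E} {c : ℝ}
    (h : dotAct R v w mu = lam - c • γ) : dotAct R v w⁻¹ lam = mu + c • w⁻¹ γ := by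
  have h' : lam + rhoR R v = w (mu + rhoR R v) + c • γ := by
    rw [sub_eq_iff_eq_add.mp h]
    abel
  have hw : w⁻¹ (w (mu + rhoR R v)) = mu + rhoR R v := w.symm_apply_apply _
  rw [dotAct, h', map_add, map_smul, hw]
  abel

/-- If `w·μ = λ − nγ` then `⟨μ+ρ,(w⁻¹γ)∨⟩ = ⟨λ+ρ,γ∨⟩ − 2n`. -/
lemma coPair_inv_of_dotAct_eq {R : Finset E} {v lam mu γ : E} {w : E ≃ₗᵢ[ℝ] E} {c : ℝ}
    (hγ : γ ≠ 0) (h : dotAct R v w mu = lam - c • γ) :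
    coPair (mu + rhoR R v) (w⁻¹ γ) = coPair (lam + rhoR R v) γ - 2 * c := by
  have hinner : ⟪γ, γ⟫_ℝ ≠ 0 := inner_self_ne_zero.mpr hγ
  have h' : w (mu + rhoR R v) = lam + rhoR R v - c • γ := by
    rw [sub_eq_iff_eq_add.mp h]
    abel
  rw [coPair_inv_apply, h', coPair, coPair, inner_sub_left, real_inner_smul_left]
  field_simp

theorem statement5 [FiniteDimensional ℝ E] (R : Finset E) (hR : IsRootSystem R)
    (v : E) (hv : ∀ α ∈ R, ⟪v, α⟫_ℝ ≠ 0)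
    (lam mu : E) (hlam : IsDominant R v lam) (hmu : IsDominant R v mu)
    (γ : E) (hγ : γ ∈ posR R v) (w : E ≃ₗᵢ[ℝ] E) (hw : w ∈ Weyl R) (n : ℤ)
    (heq : dotAct R v w mu = lam - (n : ℝ) • γ)
    (hn : n < 0 ∨ coPair (lam + rhoR R v) γ < (n : ℝ)) :
    (w⁻¹ γ ∈ posR R v →
      n < 0 ∧ 0 < -n ∧ ((-n : ℤ) : ℝ) < 2⁻¹ * coPair (mu + rhoR R v) (w⁻¹ γ) ∧
        (w⁻¹, -n) ∈ VsetB R v lam mu (w⁻¹ γ)) ∧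
    (-(w⁻¹ γ) ∈ posR R v →
      coPair (lam + rhoR R v) γ < (n : ℝ) ∧
        2⁻¹ * coPair (mu + rhoR R v) (-(w⁻¹ γ)) < (n : ℝ) ∧
        (n : ℝ) < coPair (mu + rhoR R v) (-(w⁻¹ γ)) ∧
        (w⁻¹, n) ∈ VsetB R v lam mu (-(w⁻¹ γ))) := by
  have hL := hlam.coPair_add_rhoR_pos hR hγ
  have hpair := coPair_inv_of_dotAct_eq (ne_zero_of_mem_posR hγ) heq
  have hinv := dotAct_inv_of_dotAct_eq heq
  have hw' := (Weyl R).inv_mem hw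
  constructor
  · intro hβ
    have hM := hmu.coPair_add_rhoR_pos hR hβ
    rw [hpair] at hM
    have hn0 : n < 0 := hn.resolve_right fun h => by linarith
    have hn0' : (n : ℝ) < 0 := by exact_mod_cast hn0
    refine ⟨hn0, by omega, ?_, hw', by simpa using hn0, ?_, ?_⟩
    · rw [hpair]
      push_cast
      linarith
    · simp only [hpair]
      push_cast
      linarith
    · simp only [hinv]
      push_cast
      module
  · intro hβ
    have hM := hmu.coPair_add_rhoR_pos hR hβ
    rw [coPair_neg_right, hpair] at hM
    have hn0' : (0 : ℝ) < n := by linarith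
    have hn0 : 0 < n := by exact_mod_cast hn0'
    have hgt := hn.resolve_left (by omega)
    refine ⟨hgt, ?_, ?_, hw', hn0, ?_, ?_⟩
    · rw [coPair_neg_right, hpair]
      linarith
    · rw [coPair_neg_right, hpair]
      linarith
    · simp only [coPair_neg_right, hpair]
      linarith
    · simp only [hinv]
      module

end
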